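/- Suppose the square S₀ is occupied and the component C(0) is finite. Among all plus connected S-cycles whose squares are all vacant and star adjacent to some square of C(0), which surround every square of C(0), and which surround every vacant square star adjacent to some square of C(0) not belonging to them, there exists one, G_out, that is outermost in the following sense: for every S-cycle F in this class whose dual skeleton SK(F) differs from SK(G_out), every edge of SK(F) either is an edge of SK(G_out) or is contained in the interior of SK(G_out). -/

import Mathlib

/-- Squares indexed by `ℤ × ℤ`; star adjacency: share at least a corner. -/
def starAdj (i j : ℤ × ℤ) : Prop := max |i.1 - j.1| |i.2 - j.2| = 1

/-- Plus adjacency: share an edge. -/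
def plusAdj (i j : ℤ × ℤ) : Prop := |i.1 - j.1| + |i.2 - j.2| = 1

/-- `q` is reachable from `p` by a star connected S-path (pairwise distinct squares,
consecutive squares star adjacent) avoiding all squares of `avoid`. -/
def starReach (avoid : Set (ℤ × ℤ)) (p q : ℤ × ℤ) : Prop :=
  ∃ L : List (ℤ × ℤ), L.Nodup ∧ L.Chain' starAdj ∧ L.head? = some p ∧
    L.getLast? = some q ∧ ∀ x ∈ L, x ∉ avoid

/-- The star connected occupied component of the square `S₀ = S_{(0,0)}`. -/
def C0 (ω : ℤ × ℤ → Bool) : Set (ℤ × ℤ) :=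
  {k | ω k = true ∧ starReach {x | ω x = false} (0, 0) k}

/-- A set `L` of squares surrounds the square `S ∉ L` if the set of squares reachable
from `S` by star connected S-paths avoiding all squares of `L` is finite. -/
def surrounds (L : Set (ℤ × ℤ)) (S : ℤ × ℤ) : Prop :=
  S ∉ L ∧ {k | starReach L S k}.Finite

/-- A plus connected S-cycle: pairwise distinct squares `(J₁, …, J_m)` with
`(J₁, …, J_{m-1})` a plus connected S-path and `J_m` plus adjacent to both
`J_{m-1}` and `J₁`. -/
def IsPlusCycle (V : List (ℤ × ℤ)) : Prop :=
  V ≠ [] ∧ V.Nodup ∧ V.Chain' plusAdj ∧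
    ∃ a b, V.head? = some a ∧ V.getLast? = some b ∧ plusAdj b a

/-- The dual skeleton of a plus connected S-cycle `(J₁, …, J_m)`, recorded as the
list of unit dual edges `{z_i, z_{i+1}}` (cyclically), where the dual lattice point
`z_i = J_i + (1/2, 1/2)` is identified with the index `J_i ∈ ℤ²`. -/
def skEdges (V : List (ℤ × ℤ)) : List (Sym2 (ℤ × ℤ)) :=
  (V.zip (V.rotate 1)).map fun p => s(p.1, p.2)

/-- `q` is reachable from `p` by a nearest-neighbour path in the (dual) lattice
avoiding the set `avoid`. -/
def plusReach (avoid : Set (ℤ × ℤ)) (p q : ℤ × ℤ) : Prop :=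
  ∃ L : List (ℤ × ℤ), L.Chain' plusAdj ∧ L.head? = some p ∧
    L.getLast? = some q ∧ ∀ x ∈ L, x ∉ avoid

/-- The dual lattice point `p` is in the exterior of the dual skeleton of the plus
connected S-cycle `V`: it is not an endvertex of an edge of the skeleton (the
endvertices being exactly the centres of the squares of `V`) and dual points of
arbitrarily large norm are reachable from it by nearest-neighbour dual paths
avoiding all these endvertices. -/
def extSk (V : List (ℤ × ℤ)) (p : ℤ × ℤ) : Prop :=
  p ∉ V ∧ ∀ N : ℕ, ∃ q : ℤ × ℤ, (N : ℤ) ≤ |q.1| + |q.2| ∧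
    plusReach {v | v ∈ V} p q

/-- The dual lattice point `p` is in the interior of the dual skeleton of `V`:
neither an endvertex of an edge of the skeleton nor in its exterior. -/
def intSk (V : List (ℤ × ℤ)) (p : ℤ × ℤ) : Prop :=
  p ∉ V ∧ ¬ extSk V p

/-- The class of plus connected S-cycles of vacant squares star adjacent to `C(0)`
that surround every square of `C(0)` and surround every vacant square star adjacent
to `C(0)` not belonging to them. -/
def GoodCycle (ω : ℤ × ℤ → Bool) (V : List (ℤ × ℤ)) : Prop :=
  IsPlusCycle V ∧
  (∀ v ∈ V, ω v = false ∧ ∃ c ∈ C0 ω, starAdj v c) ∧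
  (∀ c ∈ C0 ω, surrounds {x | x ∈ V} c) ∧
  (∀ y : ℤ × ℤ, ω y = false → (∃ c ∈ C0 ω, starAdj y c) → y ∉ V →
    surrounds {x | x ∈ V} y)

abbrev Pt := ℤ × ℤ

/-- Crossing indicator of the edge `u v` with the upward ray based at `q`. -/
def crossX (q u v : Pt) : ZMod 2 :=
  if u.2 = v.2 ∧ q.2 < u.2 ∧ ((u.1 = q.1 ∧ v.1 = q.1 + 1) ∨ (v.1 = q.1 ∧ u.1 = q.1 + 1))
  then 1 else 0

/-- Sum of `g` over consecutive pairs of a list. -/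
def psum (g : Pt → Pt → ZMod 2) : List Pt → ZMod 2
  | a :: b :: l => g a b + psum g (b :: l)
  | _ => 0

lemma psum_append (g : Pt → Pt → ZMod 2) (A : List Pt) (x : Pt) (B : List Pt) :
    psum g (A ++ x :: B) = psum g (A ++ [x]) + psum g (x :: B) := by
  induction A with
  | nil => simp [psum]
  | cons a A ih =>
    cases A with
    | nil => simp [psum]
    | cons a' A => simp only [List.cons_append, psum] at ih ⊢; rw [ih, add_assoc]

lemma psum_reverse (g : Pt → Pt → ZMod 2) (hg : ∀ u v, g u v = g v u) (L : List Pt) :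
    psum g L.reverse = psum g L := by
  induction L with
  | nil => rfl
  | cons a A ih =>
    cases A with
    | nil => rfl
    | cons b A =>
      have : (a :: b :: A).reverse = A.reverse ++ b :: [a] := by simp
      rw [this, psum_append]
      have h2 : A.reverse ++ [b] = (b :: A).reverse := by simp
      rw [h2, ih]
      simp only [psum]
      rw [hg a b]; ring

lemma psum_delta (s : Pt → ZMod 2) (a b : Pt) (M : List Pt) :
    psum (fun u v => s u + s v) (a :: (M ++ [b])) = s a + s b := by
  induction M generalizing a with
  | nil => simp [psum]
  | cons c M ih =>
    simp only [List.cons_append, psum]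
    rw [ih c]
    have : s c + s c = 0 := CharTwo.add_self_eq_zero _
    linear_combination this

lemma psum_add (g g' : Pt → Pt → ZMod 2) (L : List Pt) :
    psum (fun u v => g u v + g' u v) L = psum g L + psum g' L := by
  induction L with
  | nil => simp [psum]
  | cons a A ih =>
    cases A with
    | nil => simp [psum]
    | cons b A => simp only [psum] at ih ⊢; rw [ih]; ring

lemma psum_congr (R : Pt → Pt → Prop) (g g' : Pt → Pt → ZMod 2) (L : List Pt)
    (hc : L.IsChain R) (h : ∀ u ∈ L, ∀ v ∈ L, R u v → g u v = g' u v) :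
    psum g L = psum g' L := by
  induction L with
  | nil => simp [psum]
  | cons a A ih =>
    cases A with
    | nil => simp [psum]
    | cons b A =>
      simp only [psum]
      rw [List.isChain_cons_cons] at hc
      rw [h a (by simp) b (by simp) hc.1, ih hc.2]
      intro u hu v hv
      exact h u (by simp [hu]) v (by simp [hv])

lemma crossX_symm (q u v : Pt) : crossX q u v = crossX q v u := by
  unfold crossX; congr 1; apply propext; omega

/-- Winding parity of a closed list around `q`. -/
def ind (q a : Pt) (M : List Pt) : ZMod 2 := psum (crossX q) (a :: (M ++ [a]))

lemma plusAdj_cases {u v : Pt} (h : plusAdj u v) :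
    (u.1 = v.1 ∧ (u.2 = v.2 + 1 ∨ v.2 = u.2 + 1)) ∨
    (u.2 = v.2 ∧ (u.1 = v.1 + 1 ∨ v.1 = u.1 + 1)) := by
  unfold plusAdj at h
  rcases abs_cases (u.1 - v.1) with h1 | h1 <;> rcases abs_cases (u.2 - v.2) with h2 | h2 <;> omega

lemma plusAdj_of {u v : Pt} (h : (u.1 = v.1 ∧ (u.2 = v.2 + 1 ∨ v.2 = u.2 + 1)) ∨
    (u.2 = v.2 ∧ (u.1 = v.1 + 1 ∨ v.1 = u.1 + 1))) : plusAdj u v := by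
  unfold plusAdj
  rcases abs_cases (u.1 - v.1) with h1 | h1 <;> rcases abs_cases (u.2 - v.2) with h2 | h2 <;> omega

lemma starAdj_iff {u v : Pt} : starAdj u v ↔ u ≠ v ∧
    u.1 ≤ v.1 + 1 ∧ v.1 ≤ u.1 + 1 ∧ u.2 ≤ v.2 + 1 ∧ v.2 ≤ u.2 + 1 := by
  unfold starAdj
  rw [Ne, Prod.ext_iff]
  rcases abs_cases (u.1 - v.1) with h1 | h1 <;> rcases abs_cases (u.2 - v.2) with h2 | h2 <;>
    rcases max_cases |u.1 - v.1| |u.2 - v.2| with h3 | h3 <;> omega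

lemma starAdj_symm {u v : Pt} (h : starAdj u v) : starAdj v u := by
  rw [starAdj_iff] at h ⊢
  refine ⟨h.1.symm, ?_⟩
  omega

lemma plusAdj_symm {u v : Pt} (h : plusAdj u v) : plusAdj v u := by
  apply plusAdj_of
  have := plusAdj_cases h
  omega

lemma plusAdj_star {u v : Pt} (h : plusAdj u v) : starAdj u v := by
  rw [starAdj_iff, Ne, Prod.ext_iff]
  have := plusAdj_cases h
  omega

lemma mem_closed {a u : Pt} {M : List Pt} (h : u ∈ a :: (M ++ [a])) : u ∈ a :: M := by
  simp only [List.mem_cons, List.mem_append, List.not_mem_nil, or_false] at h ⊢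
  tauto

lemma ind_step_v (q q' a : Pt) (M : List Pt) (hc : (a :: (M ++ [a])).IsChain plusAdj)
    (hq' : q' ∉ a :: M) (h1 : q'.1 = q.1) (h2 : q'.2 = q.2 + 1) :
    ind q a M = ind q' a M := by
  unfold ind
  apply psum_congr _ _ _ _ hc
  intro u hu v hv huv
  have hu' : u ≠ q' := by rintro rfl; exact hq' (mem_closed hu)
  have hv' : v ≠ q' := by rintro rfl; exact hq' (mem_closed hv)
  rw [Ne, Prod.ext_iff] at hu' hv'
  unfold crossX
  congr 1
  apply propext
  omega

lemma ind_step_h (q q' a : Pt) (M : List Pt) (hc : (a :: (M ++ [a])).IsChain plusAdj)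
    (hq : q ∉ a :: M)
    (hq' : q' ∉ a :: M) (h1 : q'.1 = q.1 + 1) (h2 : q'.2 ≤ q.2 + 1) (h3 : q.2 ≤ q'.2 + 1) :
    ind q a M = ind q' a M := by
  have key : psum (fun u v => crossX q u v + crossX q' u v) (a :: (M ++ [a])) = 0 := by
    rw [psum_congr plusAdj _ (fun u v => (if u.1 = q'.1 ∧ q'.2 < u.2 then (1 : ZMod 2) else 0) +
      (if v.1 = q'.1 ∧ q'.2 < v.2 then (1 : ZMod 2) else 0)) _ hc,
      psum_delta (fun u => if u.1 = q'.1 ∧ q'.2 < u.2 then (1 : ZMod 2) else 0)]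
    · exact CharTwo.add_self_eq_zero _
    intro u hu v hv huv
    have hu' : u ≠ q' := by rintro rfl; exact hq' (mem_closed hu)
    have hv' : v ≠ q' := by rintro rfl; exact hq' (mem_closed hv)
    have hu'' : u ≠ q := by rintro rfl; exact hq (mem_closed hu)
    have hv'' : v ≠ q := by rintro rfl; exact hq (mem_closed hv)
    rw [Ne, Prod.ext_iff] at hu' hv' hu'' hv''
    have := plusAdj_cases huv
    unfold crossX
    split_ifs <;> first | decide | (exfalso; omega)
  rw [psum_add] at key
  exact CharTwo.add_eq_zero.mp key

lemma ind_star (q q' a : Pt) (M : List Pt) (hc : (a :: (M ++ [a])).IsChain plusAdj)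
    (hq : q ∉ a :: M) (hq' : q' ∉ a :: M) (h : starAdj q q') :
    ind q a M = ind q' a M := by
  rw [starAdj_iff, Ne, Prod.ext_iff] at h
  obtain h1 | h1 | h1 : q'.1 = q.1 + 1 ∨ q.1 = q'.1 + 1 ∨ q.1 = q'.1 := by omega
  · exact ind_step_h q q' a M hc hq hq' h1 (by omega) (by omega)
  · exact (ind_step_h q' q a M hc hq' hq h1 (by omega) (by omega)).symm
  · obtain h2 | h2 : q'.2 = q.2 + 1 ∨ q.2 = q'.2 + 1 := by omega
    · exact ind_step_v q q' a M hc hq' h1.symm h2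
    · exact (ind_step_v q' q a M hc hq h1 h2).symm

lemma ind_path (a : Pt) (M : List Pt) (hc : (a :: (M ++ [a])).IsChain plusAdj)
    (L : List Pt) (p q : Pt) (hL : L.IsChain starAdj) (hp : L.head? = some p)
    (hq : L.getLast? = some q) (ho : ∀ x ∈ L, x ∉ a :: M) : ind p a M = ind q a M := by
  induction L generalizing p with
  | nil => simp at hp
  | cons b A ih =>
    simp only [List.head?_cons, Option.some.injEq] at hp
    subst hp
    cases A with
    | nil => simp at hq; rw [hq]
    | cons c A =>
      rw [List.isChain_cons_cons] at hL
      rw [ind_star b c a M hc (ho b (by simp)) (ho c (by simp)) hL.1]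
      exact ih c hL.2 rfl (by simpa using hq) (fun x hx => ho x (by simp [hx]))

lemma ind_bdd (a : Pt) (M : List Pt) (hc : (a :: (M ++ [a])).IsChain plusAdj) :
    ∃ N : ℤ, ∀ k : Pt, ind k a M = 1 → |k.1| ≤ N ∧ |k.2| ≤ N := by
  have hb : ∀ L : List Pt, ∃ N : ℤ, ∀ u ∈ L, |u.1| ≤ N ∧ |u.2| ≤ N := by
    intro L
    induction L with
    | nil => exact ⟨0, by simp⟩
    | cons b A ih =>
      obtain ⟨N, hN⟩ := ih
      refine ⟨max N (max |b.1| |b.2|), ?_⟩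
      intro u hu
      rcases List.mem_cons.mp hu with rfl | hu
      · simp
      · have := hN u hu
        simp [this.1, this.2]
  obtain ⟨N, hN⟩ := hb (a :: (M ++ [a]))
  refine ⟨N + 1, fun k hk => ?_⟩
  by_contra hcon
  have hcon' : N + 1 < |k.1| ∨ N + 1 < |k.2| := by omega
  have h0 : ind k a M = 0 := by
    unfold ind
    by_cases hlow : k.2 < -N
    · rw [psum_congr plusAdj _ (fun u v => (if u.1 ≤ k.1 then (1 : ZMod 2) else 0) +
        (if v.1 ≤ k.1 then (1 : ZMod 2) else 0)) _ hc,
        psum_delta (fun u => if u.1 ≤ k.1 then (1 : ZMod 2) else 0)]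
      · exact CharTwo.add_self_eq_zero _
      intro u hu v hv huv
      have := plusAdj_cases huv
      have h1 := hN u hu
      have h2 := hN v hv
      rw [abs_le, abs_le] at h1 h2
      unfold crossX
      split_ifs <;> first | decide | (exfalso; omega)
    · rw [psum_congr plusAdj _ (fun u v => (0 : ZMod 2) + 0) _ hc,
        psum_delta (fun u => (0 : ZMod 2))]
      · simp
      intro u hu v hv huv
      have h1 := hN u hu
      have h2 := hN v hv
      rw [abs_le, abs_le] at h1 h2
      rw [lt_abs, lt_abs] at hcon'
      unfold crossX
      rw [if_neg]
      · simp
      · omega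
  rw [h0] at hk
  exact absurd hk (by decide)

lemma surrounds_of_ind (a : Pt) (M : List Pt) (hc : (a :: (M ++ [a])).IsChain plusAdj)
    (k : Pt) (hk : k ∉ a :: M) (hi : ind k a M = 1) : surrounds {x | x ∈ a :: M} k := by
  refine ⟨hk, ?_⟩
  obtain ⟨N, hN⟩ := ind_bdd a M hc
  apply (Set.finite_Icc ((-N, -N) : Pt) (N, N)).subset
  rintro q ⟨L, -, hL, hp, hq, ho⟩
  have := hN q ((ind_path a M hc L k q hL hp hq ho).symm.trans hi)
  rw [abs_le, abs_le] at this
  exact ⟨⟨this.1.1, this.2.1⟩, ⟨this.1.2, this.2.2⟩⟩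

lemma intSk_of_ind (a : Pt) (M : List Pt) (hc : (a :: (M ++ [a])).IsChain plusAdj)
    (k : Pt) (hk : k ∉ a :: M) (hi : ind k a M = 1) : intSk (a :: M) k := by
  refine ⟨hk, ?_⟩
  rintro ⟨-, h⟩
  obtain ⟨N, hN⟩ := ind_bdd a M hc
  obtain ⟨q, hq, L, hL, hp, hq', ho⟩ := h (2 * N + 1).toNat
  have := hN q ((ind_path a M hc L k q (List.IsChain.imp (fun _ _ h => plusAdj_star h) hL)
    hp hq' ho).symm.trans hi)
  omega

/-- Closed odd lists. -/
def OddL (R : Pt → Pt → Prop) (g : Pt → Pt → ZMod 2) (V : List Pt) : Prop :=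
  ∃ a M, V = a :: M ∧ (a :: (M ++ [a])).IsChain R ∧ psum g (a :: (M ++ [a])) = 1

lemma OddL.rot {R g} {A T : List Pt} {x : Pt} (h : OddL R g (A ++ x :: T)) :
    OddL R g (x :: (T ++ A)) := by
  obtain ⟨a, M, hV, hc, hp⟩ := h
  cases A with
  | nil =>
    simp only [List.nil_append, List.cons.injEq] at hV
    obtain ⟨rfl, rfl⟩ := hV
    exact ⟨x, T, by simp, hc, hp⟩
  | cons b A =>
    simp only [List.cons_append, List.cons.injEq] at hV
    obtain ⟨rfl, rfl⟩ := hV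
    have e : b :: (A ++ x :: T ++ [b]) = (b :: A) ++ x :: (T ++ [b]) := by simp
    have e2 : x :: (T ++ b :: A ++ [x]) = (x :: T) ++ b :: (A ++ [x]) := by simp
    rw [e, List.isChain_split] at hc
    rw [e, psum_append] at hp
    refine ⟨x, T ++ b :: A, rfl, ?_, ?_⟩
    · rw [e2, List.isChain_split]; exact ⟨hc.2, hc.1⟩
    · rw [e2, psum_append, ← hp, add_comm]; rfl

lemma zmod2_split {s t : ZMod 2} (h : s + t = 1) : s = 1 ∨ t = 1 := by
  revert s t; decide

lemma exists_dup {L : List Pt} (h : ¬ L.Nodup) :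
    ∃ A x B T, L = A ++ x :: (B ++ x :: T) := by
  induction L with
  | nil => simp at h
  | cons a L ih =>
    rw [List.nodup_cons, not_and_or, not_not] at h
    rcases h with h | h
    · obtain ⟨B, T, rfl⟩ := List.append_of_mem h
      exact ⟨[], a, B, T, rfl⟩
    · obtain ⟨A, x, B, T, rfl⟩ := ih h
      exact ⟨a :: A, x, B, T, rfl⟩

lemma OddL.nodup_of_min {R g} {V : List Pt} (h : OddL R g V)
    (hmin : ∀ V', OddL R g V' → V.length ≤ V'.length) : V.Nodup := by
  by_contra hn
  obtain ⟨A, x, B, T, rfl⟩ := exists_dup hn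
  have h' := h.rot
  obtain ⟨a, M, hV, hc, hp⟩ := h'
  simp only [List.cons.injEq] at hV
  obtain ⟨rfl, rfl⟩ := hV
  have e : x :: (B ++ x :: T ++ A ++ [x]) = (x :: B) ++ x :: (T ++ A ++ [x]) := by simp
  rw [e, List.isChain_split] at hc
  rw [e, psum_append] at hp
  rcases zmod2_split hp with h1 | h1
  · have := hmin (x :: B) ⟨x, B, rfl, hc.1, h1⟩
    simp at this; omega
  · have := hmin (x :: (T ++ A)) ⟨x, T ++ A, rfl, hc.2, h1⟩
    simp at this; omega

lemma skEdges_rotate (V : List Pt) (n : ℕ) : skEdges (V.rotate n) = (skEdges V).rotate n := by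
  unfold skEdges
  rw [← List.map_rotate, List.zip_eq_zipWith, List.zip_eq_zipWith,
    List.zipWith_rotate_distrib _ _ _ _ (by simp),
    List.rotate_rotate, List.rotate_rotate, Nat.add_comm]

lemma mem_skEdges_rot (A T : List Pt) (e : Sym2 Pt) :
    e ∈ skEdges (A ++ T) ↔ e ∈ skEdges (T ++ A) := by
  rw [← List.rotate_append_length_eq A T, skEdges_rotate, List.mem_rotate]

lemma OddL.chordless_aux {R g} (hR : ∀ u v, R u v → R v u) (hg : ∀ u v, g u v = g v u)
    {V : List Pt} (h : OddL R g V)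
    (hmin : ∀ V', OddL R g V' → V.length ≤ V'.length) {A B T : List Pt} {a b : Pt}
    (hV : V = A ++ a :: (B ++ b :: T)) (hab : R a b) : s(a, b) ∈ skEdges V := by
  subst hV
  obtain ⟨a', M, hV, hc, hp⟩ := h.rot
  simp only [List.cons.injEq] at hV
  obtain ⟨rfl, rfl⟩ := hV
  rw [mem_skEdges_rot]
  have e : a :: (B ++ b :: T ++ A ++ [a]) = (a :: B) ++ b :: (T ++ A ++ [a]) := by simp
  rw [e, List.isChain_split] at hc
  rw [e, psum_append] at hp
  have e1 : a :: (B ++ [b] ++ [a]) = (a :: B) ++ b :: [a] := by simp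
  have e2 : b :: (T ++ A ++ [a] ++ [b]) = (b :: (T ++ A)) ++ a :: [b] := by simp
  have c1 : (a :: (B ++ [b] ++ [a])).IsChain R := by
    rw [e1, List.isChain_split]; exact ⟨hc.1, by simpa using hR _ _ hab⟩
  have c2 : (b :: (T ++ A ++ [a] ++ [b])).IsChain R := by
    rw [e2, List.isChain_split]; exact ⟨hc.2, by simpa using hab⟩
  have p12 : psum g (a :: (B ++ [b] ++ [a])) + psum g (b :: (T ++ A ++ [a] ++ [b])) = 1 := by
    rw [e1, e2, psum_append, psum_append g (b :: (T ++ A)), ← hp]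
    have e4 : b :: (T ++ A) ++ [a] = b :: (T ++ A ++ [a]) := by simp
    rw [e4]
    simp only [psum]
    rw [hg b a]
    have : g a b + g a b = 0 := CharTwo.add_self_eq_zero _
    linear_combination this
  rcases zmod2_split p12 with h1 | h1
  · have := hmin (a :: (B ++ [b])) ⟨a, _, rfl, c1, h1⟩
    simp at this
    have hT : T = [] := List.length_eq_zero_iff.mp (by omega)
    have hA : A = [] := List.length_eq_zero_iff.mp (by omega)
    subst hT hA
    have e3 : a :: (B ++ [b]) ++ [] = (a :: B) ++ [b] := by simp
    rw [e3, mem_skEdges_rot]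
    simp [skEdges, Sym2.eq_swap]
  · have := hmin (b :: (T ++ A ++ [a])) ⟨b, _, rfl, c2, h1⟩
    simp at this
    have hB : B = [] := List.length_eq_zero_iff.mp (by omega)
    subst hB
    simp [skEdges]

lemma OddL.chordless {R g} (hR : ∀ u v, R u v → R v u) (hg : ∀ u v, g u v = g v u)
    {V : List Pt} (h : OddL R g V)
    (hmin : ∀ V', OddL R g V' → V.length ≤ V'.length) {a b : Pt} (ha : a ∈ V) (hb : b ∈ V)
    (hne : a ≠ b) (hab : R a b) : s(a, b) ∈ skEdges V := by
  obtain ⟨A, T, hV⟩ := List.append_of_mem ha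
  have hb' := hb
  rw [hV, List.mem_append, List.mem_cons] at hb'
  rcases hb' with h1 | h1 | h1
  · obtain ⟨A1, A2, rfl⟩ := List.append_of_mem h1
    rw [Sym2.eq_swap]
    exact h.chordless_aux hR hg hmin (A := A1) (B := A2) (T := T) (by simp [hV]) (hR _ _ hab)
  · exact absurd h1.symm hne
  · obtain ⟨A1, A2, rfl⟩ := List.append_of_mem h1
    exact h.chordless_aux hR hg hmin hV hab

/-- `v` reachable from `u` with parity `t`. -/
def WP (R : Pt → Pt → Prop) (g : Pt → Pt → ZMod 2) (u v : Pt) (t : ZMod 2) : Prop :=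
  ∃ L : List Pt, L.IsChain R ∧ L.head? = some u ∧ L.getLast? = some v ∧ psum g L = t

lemma WP.refl (R g u) : WP R g u u 0 := ⟨[u], by simp, rfl, rfl, rfl⟩

lemma WP.step {R g u v} (h : R u v) : WP R g u v (g u v) :=
  ⟨[u, v], by simpa using h, rfl, rfl, by simp [psum]⟩

lemma WP.trans {R g u v w s t} (h : WP R g u v s) (h' : WP R g v w t) : WP R g u w (s + t) := by
  obtain ⟨L, hc, hu, hv, rfl⟩ := h
  obtain ⟨L', hc', hv', hw, rfl⟩ := h'
  obtain ⟨A, rfl⟩ := List.getLast?_eq_some_iff.mp hv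
  obtain ⟨B, rfl⟩ := List.head?_eq_some_iff.mp hv'
  refine ⟨A ++ v :: B, List.isChain_split.mpr ⟨hc, hc'⟩, ?_, ?_, psum_append _ _ _ _⟩
  · cases A <;> simpa using hu
  · simpa [List.getLast?_append] using hw

lemma WP.symm {R g u v s} (hR : ∀ u v, R u v → R v u) (hg : ∀ u v, g u v = g v u)
    (h : WP R g u v s) : WP R g v u s := by
  obtain ⟨L, hc, hu, hv, rfl⟩ := h
  refine ⟨L.reverse, ?_, by simpa using hv, by simpa using hu, psum_reverse g hg L⟩
  rw [List.isChain_reverse]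
  exact List.IsChain.imp (fun _ _ h => hR _ _ h) hc

lemma exists_potential (R : Pt → Pt → Prop) (g : Pt → Pt → ZMod 2)
    (hR : ∀ u v, R u v → R v u) (hg : ∀ u v, g u v = g v u)
    (hno : ¬ ∃ V, OddL R g V) : ∃ f : Pt → ZMod 2, ∀ u v, R u v → g u v + f u + f v = 0 := by
  have hcl : ∀ u t, WP R g u u t → t = 0 := by
    rintro u t ⟨L, hc, hu, hv, rfl⟩
    obtain ⟨B, rfl⟩ := List.head?_eq_some_iff.mp hu
    rcases List.eq_nil_or_concat B with rfl | ⟨B, b, rfl⟩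
    · rfl
    · have hb : b = u := by simpa [List.getLast?_cons] using hv
      subst hb
      by_contra hne
      apply hno
      refine ⟨b :: B, b, B, rfl, by simpa using hc, ?_⟩
      have : ∀ t : ZMod 2, t ≠ 0 → t = 1 := by decide
      apply this
      simpa using hne
  let S : Setoid Pt := ⟨fun u v => ∃ t, WP R g u v t, ⟨fun u => ⟨0, WP.refl R g u⟩,
    fun ⟨t, h⟩ => ⟨t, h.symm hR hg⟩, fun ⟨s, h⟩ ⟨t, h'⟩ => ⟨s + t, h.trans h'⟩⟩⟩
  have hrep : ∀ u : Pt, ∃ t, WP R g (Quotient.out (Quotient.mk S u)) u t :=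
    fun u => Quotient.exact (s := S) (Quotient.out_eq _)
  choose f hf using hrep
  refine ⟨f, fun u v huv => ?_⟩
  have hq : Quotient.mk S u = Quotient.mk S v := Quotient.sound ⟨_, WP.step huv⟩
  have h1 := hf u
  rw [hq] at h1
  have := hcl _ _ ((h1.trans (WP.step huv)).trans ((hf v).symm hR hg))
  rw [← this]; ring

lemma C0_step (ω : Pt → Bool) {c u : Pt} (hc : c ∈ C0 ω) (hu : ω u = true) (h : starAdj c u) :
    u ∈ C0 ω := by
  refine ⟨hu, ?_⟩
  obtain ⟨-, L, hn, hL, hp, hq, ho⟩ := hc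
  by_cases hm : u ∈ L
  · obtain ⟨A, B, rfl⟩ := List.append_of_mem hm
    refine ⟨A ++ [u], ?_, (List.isChain_split.mp hL).1, ?_, by simp, ?_⟩
    · have e : A ++ u :: B = (A ++ [u]) ++ B := by simp
      rw [e] at hn
      exact hn.of_append_left
    · cases A <;> simpa using hp
    · intro x hx
      apply ho
      simp at hx ⊢
      tauto
  · refine ⟨L ++ [u], ?_, ?_, ?_, by simp, ?_⟩
    · rw [List.nodup_append]
      refine ⟨hn, by simp, ?_⟩
      rintro a ha b hb rfl
      simp at hb
      subst hb
      exact hm ha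
    · obtain ⟨A, rfl⟩ := List.getLast?_eq_some_iff.mp hq
      have e : A ++ [c] ++ [u] = A ++ c :: [u] := by simp
      change List.IsChain starAdj _
      rw [e, List.isChain_split]
      exact ⟨hL, by simpa using h⟩
    · simp [hp]
    · intro x hx
      rw [List.mem_append, List.mem_singleton] at hx
      rcases hx with hx | rfl
      · exact ho x hx
      · simp [hu]

lemma exists_odd (C B : Set Pt) (hfin : C.Finite) (h0 : ((0, 0) : Pt) ∈ C)
    (hB : ∀ c ∈ C, ∀ u, starAdj c u → u ∈ C ∨ u ∈ B) :
    ∃ V, OddL (fun u v => plusAdj u v ∧ u ∈ B ∧ v ∈ B) (crossX (0, 0)) V := by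
  classical
  by_contra hno
  obtain ⟨f, hf⟩ := exists_potential _ (crossX (0, 0))
    (fun u v h => ⟨plusAdj_symm h.1, h.2.2, h.2.1⟩) (crossX_symm _) hno
  set r : Pt → Pt := fun p => (p.1 + 1, p.2) with hr
  set t : Pt → Pt := fun p => (p.1, p.2 + 1) with ht
  let G : Pt → Pt → ZMod 2 := fun u v =>
    if u ∈ C ∨ v ∈ C then crossX (0, 0) u v + f u + f v else 0
  let H : Pt → ZMod 2 := fun p => G p (r p)
  let W : Pt → ZMod 2 := fun p => G p (t p)
  have hri : Function.Injective r := by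
    intro p q h; simp only [hr, Prod.ext_iff] at h ⊢; omega
  have hti : Function.Injective t := by
    intro p q h; simp only [ht, Prod.ext_iff] at h ⊢; omega
  have hrb : Function.Bijective r :=
    ⟨hri, fun p => ⟨(p.1 - 1, p.2), by simp [hr]⟩⟩
  have htb : Function.Bijective t :=
    ⟨hti, fun p => ⟨(p.1, p.2 - 1), by simp [ht]⟩⟩
  have hfH : H.support.Finite := by
    apply (hfin.union (hfin.preimage hri.injOn)).subset
    intro p hp
    by_contra hcon
    apply hp
    exact if_neg hcon
  have hfW : W.support.Finite := by
    apply (hfin.union (hfin.preimage hti.injOn)).subset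
    intro p hp
    by_contra hcon
    apply hp
    exact if_neg hcon
  have hfH' : (fun p => H (t p)).support.Finite := hfH.preimage hti.injOn
  have hfW' : (fun p => W (r p)).support.Finite := hfW.preimage hri.injOn
  have tot : ∑ᶠ p, ((H p + H (t p)) + (W p + W (r p))) = 0 := by
    rw [finsum_add_distrib ((hfH.union hfH').subset (Function.support_add _ _))
      ((hfW.union hfW').subset (Function.support_add _ _)),
      finsum_add_distrib hfH hfH', finsum_add_distrib hfW hfW']
    have e1 : ∑ᶠ p, H (t p) = ∑ᶠ p, H p :=
      finsum_eq_of_bijective t htb (fun _ => rfl)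
    have e2 : ∑ᶠ p, W (r p) = ∑ᶠ p, W p :=
      finsum_eq_of_bijective r hrb (fun _ => rfl)
    rw [e1, e2, CharTwo.add_self_eq_zero, CharTwo.add_self_eq_zero, add_zero]
  have face : ∀ p, (H p + H (t p)) + (W p + W (r p)) = if p = (0, 0) then 1 else 0 := by
    intro p
    by_cases hp : p ∈ C ∨ r p ∈ C ∨ t p ∈ C ∨ r (t p) ∈ C
    · obtain ⟨c, hc, hcp⟩ : ∃ c ∈ C, p.1 ≤ c.1 ∧ c.1 ≤ p.1 + 1 ∧ p.2 ≤ c.2 ∧ c.2 ≤ p.2 + 1 := by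
        rcases hp with h | h | h | h
        · exact ⟨_, h, by omega⟩
        · exact ⟨_, h, by simp [hr]⟩
        · exact ⟨_, h, by simp [ht]⟩
        · exact ⟨_, h, by simp [hr, ht]⟩
      have hG : ∀ u v : Pt, plusAdj u v → (p.1 ≤ u.1 ∧ u.1 ≤ p.1 + 1 ∧ p.2 ≤ u.2 ∧ u.2 ≤ p.2 + 1) →
          (p.1 ≤ v.1 ∧ v.1 ≤ p.1 + 1 ∧ p.2 ≤ v.2 ∧ v.2 ≤ p.2 + 1) →
          G u v = crossX (0, 0) u v + f u + f v := by
        intro u v huv hu hv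
        by_cases hm : u ∈ C ∨ v ∈ C
        · exact if_pos hm
        · have hmem : ∀ w : Pt, w ∉ C →
              (p.1 ≤ w.1 ∧ w.1 ≤ p.1 + 1 ∧ p.2 ≤ w.2 ∧ w.2 ≤ p.2 + 1) → w ∈ B := by
            intro w hw hwp
            refine (hB c hc w ?_).resolve_left hw
            rw [starAdj_iff]
            refine ⟨?_, by omega⟩
            rintro rfl; exact hw hc
          push Not at hm
          rw [hf u v ⟨huv, hmem u hm.1 hu, hmem v hm.2 hv⟩]
          exact if_neg (by tauto)
      have a1 : H p = _ := hG p (r p) (plusAdj_of (by simp [hr])) (by omega) (by simp [hr])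
      have a2 : H (t p) = _ := hG (t p) (r (t p)) (plusAdj_of (by simp [hr])) (by simp [ht])
        (by simp [hr, ht])
      have a3 : W p = _ := hG p (t p) (plusAdj_of (by simp [ht])) (by omega) (by simp [ht])
      have a4 : W (r p) = _ := hG (r p) (t (r p)) (plusAdj_of (by simp [ht])) (by simp [hr])
        (by simp [hr, ht])
      have e : t (r p) = r (t p) := rfl
      rw [a1, a2, a3, a4, e]
      have two : ∀ x : ZMod 2, x + x = 0 := CharTwo.add_self_eq_zero
      have key : crossX (0, 0) p (r p) + crossX (0, 0) (t p) (r (t p)) + crossX (0, 0) p (t p)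
          + crossX (0, 0) (r p) (r (t p)) = if p = (0, 0) then 1 else 0 := by
        obtain ⟨x, y⟩ := p
        simp only [crossX, hr, ht, Prod.mk.injEq, true_and]
        split_ifs <;> first | decide | (exfalso; omega)
      rw [← key]
      linear_combination two (f p) + two (f (r p)) + two (f (t p)) + two (f (r (t p)))
    · push Not at hp
      have e : t (r p) = r (t p) := rfl
      have a1 : H p = 0 := if_neg (by tauto)
      have a2 : H (t p) = 0 := if_neg (by tauto)
      have a3 : W p = 0 := if_neg (by tauto)
      have a4 : W (r p) = 0 := if_neg (by rw [e]; tauto)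
      rw [a1, a2, a3, a4, if_neg]
      · simp
      · rintro rfl; exact hp.1 h0
  rw [finsum_congr face, finsum_eq_single _ ((0, 0) : Pt) (fun x hx => if_neg hx)] at tot
  simp at tot

lemma cycle_edge (a c : Pt) (M : List Pt) (hc : (a :: (M ++ [c])).IsChain plusAdj) :
    ∀ p ∈ (a :: M).zip (M ++ [c]), plusAdj p.1 p.2 := by
  induction M generalizing a with
  | nil => intro p hp; simp at hp; subst hp; simpa using hc
  | cons b M ih =>
    intro p hp
    simp only [List.cons_append, List.isChain_cons_cons] at hc
    simp only [List.cons_append, List.zip_cons_cons, List.mem_cons] at hp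
    rcases hp with rfl | hp
    · exact hc.1
    · exact ih b (by simpa using hc.2) p hp

/-- Among the S-cycles of the class `GoodCycle`, there is an outermost one
`G_out`: for every `F` in the class whose dual skeleton differs from that of
`G_out`, every edge of `SK(F)` either is an edge of `SK(G_out)` or is contained in
the interior of `SK(G_out)` (i.e. has an endvertex in the interior). -/
theorem exists_outermost_vacant_plus_cycle
    (ω : ℤ × ℤ → Bool) (h0 : ω (0, 0) = true) (hfin : (C0 ω).Finite) :
    ∃ G : List (ℤ × ℤ), GoodCycle ω G ∧
      ∀ F : List (ℤ × ℤ), GoodCycle ω F →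
        {e | e ∈ skEdges F} ≠ {e | e ∈ skEdges G} →
        ∀ e ∈ skEdges F, e ∈ skEdges G ∨ ∃ v ∈ e, intSk G v := by
  classical
  set B : Set Pt := {v | ω v = false ∧ ∃ c ∈ C0 ω, starAdj v c} with hBdef
  set R : Pt → Pt → Prop := fun u v => plusAdj u v ∧ u ∈ B ∧ v ∈ B with hRdef
  have hR : ∀ u v, R u v → R v u := fun u v h => ⟨plusAdj_symm h.1, h.2.2, h.2.1⟩
  have h0C : ((0, 0) : Pt) ∈ C0 ω := ⟨h0, [(0, 0)], by simp, List.isChain_singleton _, rfl, rfl, by simp [h0]⟩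
  have hex : ∃ n, ∃ V, OddL R (crossX (0, 0)) V ∧ V.length = n := by
    obtain ⟨V, hV⟩ := exists_odd (C0 ω) B hfin h0C (by
      intro c hc u hcu
      by_cases hu : ω u = true
      · exact Or.inl (C0_step ω hc hu hcu)
      · exact Or.inr ⟨by simpa using hu, c, hc, starAdj_symm hcu⟩)
    exact ⟨_, V, hV, rfl⟩
  obtain ⟨V, hV, hlen⟩ := Nat.find_spec hex
  have hmin : ∀ V', OddL R (crossX (0, 0)) V' → V.length ≤ V'.length := by
    intro V' hV'
    rw [hlen]
    exact Nat.find_min' hex ⟨V', hV', rfl⟩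
  have hnd := hV.nodup_of_min hmin
  have hV' := hV
  obtain ⟨a, M, rfl, hc, hp⟩ := hV'
  have hcp : (a :: (M ++ [a])).IsChain plusAdj := List.IsChain.imp (fun _ _ h => h.1) hc
  have hlast : ∃ b, (a :: M).getLast? = some b ∧ R b a := by
    rcases List.eq_nil_or_concat (a :: M) with h | ⟨A, b, h⟩
    · simp at h
    · refine ⟨b, by simp [h], ?_⟩
      have e : a :: (M ++ [a]) = A ++ b :: [a] := by
        rw [← List.cons_append, h]; simp
      rw [e, List.isChain_split] at hc
      simpa using hc.2
  have hVB : ∀ v ∈ a :: M, v ∈ B := by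
    have : ∀ (L : List Pt) (x : Pt), (x :: (L ++ [a])).IsChain R → ∀ v ∈ x :: L, v ∈ B := by
      intro L
      induction L with
      | nil => intro x hx v hv; simp at hx hv; subst hv; exact hx.2.1
      | cons y L ih =>
        intro x hx v hv
        simp only [List.cons_append, List.isChain_cons_cons] at hx
        rcases List.mem_cons.mp hv with rfl | hv
        · exact hx.1.2.1
        · exact ih y (by simpa using hx.2) v hv
    exact this M a hc
  have hCoff : ∀ c, ω c = true → c ∉ a :: M := by
    intro c hc hm
    have := (hVB c hm).1
    rw [hc] at this
    exact absurd this (by simp)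
  have hCind : ∀ c ∈ C0 ω, ind c a M = 1 := by
    rintro c ⟨-, L, -, hL, hh, hl, ho⟩
    rw [← ind_path a M hcp L _ c hL hh hl (fun x hx => hCoff x (by simpa using ho x hx))]
    exact hp
  have hBind : ∀ y ∈ B, y ∉ a :: M → ind y a M = 1 := by
    rintro y ⟨-, c, hc, hyc⟩ hy
    rw [ind_star y c a M hcp hy (hCoff c hc.1) hyc]
    exact hCind c hc
  refine ⟨a :: M, ⟨⟨by simp, hnd, ?_, ?_⟩, hVB, ?_, ?_⟩, ?_⟩
  · exact (List.IsChain.left_of_append (l₂ := [a]) (by simpa using hcp))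
  · obtain ⟨b, hb, hba⟩ := hlast
    exact ⟨a, b, rfl, hb, hba.1⟩
  · intro c hc
    exact surrounds_of_ind a M hcp c (hCoff c hc.1) (hCind c hc)
  · intro y hy hyc hyV
    exact surrounds_of_ind a M hcp y hyV (hBind y ⟨hy, hyc⟩ hyV)
  · rintro F ⟨⟨-, -, hFc, x, b, hx, hb, hbx⟩, hFB, -, -⟩ - e he
    obtain ⟨N, rfl⟩ := List.head?_eq_some_iff.mp hx
    have hFc' : (x :: (N ++ [x])).IsChain plusAdj := by
      obtain ⟨A, hA⟩ := List.getLast?_eq_some_iff.mp hb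
      have e : x :: (N ++ [x]) = A ++ b :: [x] := by
        rw [← List.cons_append, hA]; simp
      rw [e, List.isChain_split]
      exact ⟨by rw [← hA]; exact hFc, by simpa using hbx⟩
    unfold skEdges at he
    rw [List.mem_map] at he
    obtain ⟨⟨u, v⟩, hm, rfl⟩ := he
    have hmem := List.of_mem_zip hm
    have hu := hFB u hmem.1
    have hv := hFB v (by simpa only [List.mem_rotate] using hmem.2)
    have huv : plusAdj u v := cycle_edge x x N hFc' (u, v) (by simpa using hm)
    by_cases hu' : u ∈ a :: M
    · by_cases hv' : v ∈ a :: M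
      · left
        refine hV.chordless hR (crossX_symm _) hmin hu' hv' ?_ ⟨huv, hu, hv⟩
        intro heq
        change u = v at heq
        subst heq
        have := plusAdj_cases huv
        omega
      · right
        exact ⟨v, by simp, intSk_of_ind a M hcp v hv' (hBind v hv hv')⟩
    · right
      exact ⟨u, by simp, intSk_of_ind a M hcp u hu' (hBind u hu hu')⟩
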